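/- arXiv:2405.00421 — 7 statements merged into one kernel-verified Lean document; each statement's English description precedes it below -/
import Mathlib

section
/- Let a⁺, a⁻ > 0 be real numbers, let b⁺, b⁻ ∈ ℝ, and let J ∈ ℝ with J ≠ 0. Then there exist real numbers μ⁺, μ⁻ satisfying μ⁺·b⁺ − μ⁻·b⁻ = J, |μ⁺| < 1/a⁺ and |μ⁻| < 1/a⁻ if and only if |J| < |b⁺|/a⁺ + |b⁻|/a⁻. -/
/-- Every real number is turned into its absolute value by a factor of absolute value one. -/
theorem exists_abs_eq_one_mul_eq_abs (b : ℝ) : ∃ s : ℝ, |s| = 1 ∧ s * b = |b| := by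
  rcases abs_choice b with h | h
  · exact ⟨1, by simp, by rw [h, one_mul]⟩
  · exact ⟨-1, by simp, by rw [h, neg_one_mul]⟩

/-- 2D Friedrichs symmetrizer lemma: existence of symmetrizer coefficients
`μ⁺, μ⁻` with `μ⁺·b⁺ − μ⁻·b⁻ = J` and the hyperbolicity constraints
`|μ±| < 1/a±` is equivalent to the 2D stability condition
`|J| < |b⁺|/a⁺ + |b⁻|/a⁻`. -/
theorem stmt_0 (ap am bp bm J : ℝ) (hap : 0 < ap) (ham : 0 < am) (hJ : J ≠ 0) :
    (∃ μp μm : ℝ, μp * bp - μm * bm = J ∧ |μp| < 1 / ap ∧ |μm| < 1 / am) ↔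
      |J| < |bp| / ap + |bm| / am := by
  constructor
  · rintro ⟨μp, μm, rfl, hp, hm⟩
    have h_tri : |μp * bp - μm * bm| ≤ |μp| * |bp| + |μm| * |bm| := by
      simpa only [abs_mul] using abs_sub (μp * bp) (μm * bm)
    refine h_tri.trans_lt ?_
    rw [← one_div_mul_eq_div ap, ← one_div_mul_eq_div am]
    rcases eq_or_ne bp 0 with rfl | hbp
    · have hbm : bm ≠ 0 := by
        rintro rfl
        simp at hJ
      exact add_lt_add_of_le_of_lt (by simp) (mul_lt_mul_of_pos_right hm (abs_pos.2 hbm))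
    · exact add_lt_add_of_lt_of_le (mul_lt_mul_of_pos_right hp (abs_pos.2 hbp))
        (mul_le_mul_of_nonneg_right hm.le (abs_nonneg bm))
  · intro h
    obtain ⟨sp, hsp, hbp⟩ := exists_abs_eq_one_mul_eq_abs bp
    obtain ⟨sm, hsm, hbm⟩ := exists_abs_eq_one_mul_eq_abs bm
    set S := |bp| / ap + |bm| / am with hS
    have hS_pos : 0 < S := (abs_nonneg J).trans_lt h
    have ht : |J / S| < 1 := by
      rwa [abs_div, abs_of_pos hS_pos, div_lt_one hS_pos]
    refine ⟨J / S * sp / ap, -(J / S * sm / am), ?_, ?_, ?_⟩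
    · calc J / S * sp / ap * bp - -(J / S * sm / am) * bm
          = J / S * (sp * bp / ap + sm * bm / am) := by ring
        _ = J := by rw [hbp, hbm, ← hS, div_mul_cancel₀ J hS_pos.ne']
    · rw [abs_div, abs_mul, hsp, mul_one, abs_of_pos hap]
      exact div_lt_div_of_pos_right ht hap
    · rw [abs_neg, abs_div, abs_mul, hsm, mul_one, abs_of_pos ham]
      exact div_lt_div_of_pos_right ht ham
end

section
/- Let a⁺, a⁻ > 0 be real numbers, let b⁺, b⁻ ∈ ℝ be not both zero, and let J ∈ ℝ satisfy |J| < |b⁺|/a⁺ + |b⁻|/a⁻. Set D = a⁻·|b⁺| + a⁺·|b⁻| (so D > 0), and define μ⁺ = sgn(b⁺)·a⁻·J/D and μ⁻ = −sgn(b⁻)·a⁺·J/D, where sgn denotes the sign function (sgn 0 = 0). Then μ⁺·b⁺ − μ⁻·b⁻ = J, |μ⁺| < 1/a⁺ and |μ⁻| < 1/a⁻. -/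
theorem Real.sign_mul_self_eq_abs (r : ℝ) : Real.sign r * r = |r| := by
  rcases lt_trichotomy r 0 with h | rfl | h
  · rw [Real.sign_of_neg h, abs_of_neg h, neg_one_mul]
  · simp
  · rw [Real.sign_of_pos h, abs_of_pos h, one_mul]

theorem Real.abs_sign_le_one (r : ℝ) : |Real.sign r| ≤ 1 := by
  rcases Real.sign_apply_eq r with h | h | h <;> simp [h]

theorem abs_mul_mul_div_lt_one_div {s a c J D : ℝ} (hs : |s| ≤ 1) (ha : 0 < a) (hc : 0 < c)
    (hD : 0 < D) (h : |J| * (a * c) < D) : |s * a * J / D| < 1 / c := by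
  rw [abs_div, abs_mul, abs_mul, abs_of_pos ha, abs_of_pos hD, div_lt_div_iff₀ hD hc, one_mul]
  calc |s| * a * |J| * c = |s| * (|J| * (a * c)) := by ring
    _ ≤ 1 * (|J| * (a * c)) := by gcongr
    _ < D := by rwa [one_mul]

/-- Explicit choice of the 2D Friedrichs symmetrizer: with
`D = a⁻·|b⁺| + a⁺·|b⁻| > 0`, the functions `μ⁺ = sgn(b⁺)·a⁻·J/D` and
`μ⁻ = −sgn(b⁻)·a⁺·J/D` satisfy `μ⁺·b⁺ − μ⁻·b⁻ = J` together with the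
hyperbolicity constraints `|μ±| < 1/a±`, under the 2D stability condition. -/
theorem stmt_1 (ap am bp bm J : ℝ) (hap : 0 < ap) (ham : 0 < am)
    (hb : ¬(bp = 0 ∧ bm = 0))
    (hJ : |J| < |bp| / ap + |bm| / am) :
    0 < am * |bp| + ap * |bm| ∧
    (Real.sign bp * am * J / (am * |bp| + ap * |bm|)) * bp -
      (-Real.sign bm * ap * J / (am * |bp| + ap * |bm|)) * bm = J ∧
    |Real.sign bp * am * J / (am * |bp| + ap * |bm|)| < 1 / ap ∧
    |(-Real.sign bm * ap * J / (am * |bp| + ap * |bm|))| < 1 / am := by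
  have hbound : |J| * (am * ap) < am * |bp| + ap * |bm| := by
    calc |J| * (am * ap) < (|bp| / ap + |bm| / am) * (am * ap) := by gcongr
      _ = am * |bp| + ap * |bm| := by field_simp
  have hD : 0 < am * |bp| + ap * |bm| := lt_of_le_of_lt (by positivity) hbound
  refine ⟨hD, ?_, ?_, ?_⟩
  · rw [div_mul_eq_mul_div, div_mul_eq_mul_div, ← sub_div, div_eq_iff hD.ne',
      ← Real.sign_mul_self_eq_abs bp, ← Real.sign_mul_self_eq_abs bm]
    ring
  · exact abs_mul_mul_div_lt_one_div (Real.abs_sign_le_one bp) ham hap hD hbound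
  · exact abs_mul_mul_div_lt_one_div (by simpa using Real.abs_sign_le_one bm) hap ham hD
      (by rwa [mul_comm ap am])
end

section
/- For vectors a, b ∈ ℝ², write a × b := a₁b₂ − a₂b₁ for the scalar cross product. Let b⁺, b⁻, w ∈ ℝ², let a⁺, a⁻ > 0, and let δ₀ ∈ (0, 1/8). Assume the 3D stability condition: b⁺ × b⁻ ≠ 0 and δ₀ ≤ a⁺·|b⁻ × w| ≤ (1−δ₀)·|b⁺ × b⁻| and δ₀ ≤ a⁻·|b⁺ × w| ≤ (1−δ₀)·|b⁺ × b⁻|. Then any real numbers μ⁺, μ⁻ with μ⁺·b⁺ − μ⁻·b⁻ = w satisfy a⁺·|μ⁺| ≤ 1−δ₀ and a⁻·|μ⁻| ≤ 1−δ₀; in particular |μ⁺| < 1/a⁺ and |μ⁻| < 1/a⁻. -/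
/-- Scalar cross product of two vectors in `ℝ²`. -/
def cross2 (a b : ℝ × ℝ) : ℝ := a.1 * b.2 - a.2 * b.1

theorem cross2_smul_sub_smul_right (s t : ℝ) (a b : ℝ × ℝ) :
    cross2 b (s • a - t • b) = -(s * cross2 a b) := by
  simp only [cross2, Prod.fst_sub, Prod.snd_sub, Prod.smul_fst, Prod.smul_snd, smul_eq_mul]
  ring

theorem cross2_smul_sub_smul_left (s t : ℝ) (a b : ℝ × ℝ) :
    cross2 a (s • a - t • b) = -(t * cross2 a b) := by
  simp only [cross2, Prod.fst_sub, Prod.snd_sub, Prod.smul_fst, Prod.smul_snd, smul_eq_mul]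
  ring

/-- The 3D stability condition guarantees the hyperbolicity constraint for
the Friedrichs symmetrizer: any `μ⁺, μ⁻` with `μ⁺·b⁺ − μ⁻·b⁻ = w` satisfy
`a±·|μ±| ≤ 1 − δ₀`, and in particular `|μ±| < 1/a±`. -/
theorem stmt_3 (bp bm w : ℝ × ℝ) (ap am δ₀ : ℝ) (hap : 0 < ap) (ham : 0 < am)
    (hδ : δ₀ ∈ Set.Ioo (0 : ℝ) (1/8))
    (hnc : cross2 bp bm ≠ 0)
    (h1l : δ₀ ≤ ap * |cross2 bm w|) (h1r : ap * |cross2 bm w| ≤ (1 - δ₀) * |cross2 bp bm|)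
    (h2l : δ₀ ≤ am * |cross2 bp w|) (h2r : am * |cross2 bp w| ≤ (1 - δ₀) * |cross2 bp bm|) :
    ∀ μp μm : ℝ, μp • bp - μm • bm = w →
      ap * |μp| ≤ 1 - δ₀ ∧ am * |μm| ≤ 1 - δ₀ ∧ |μp| < 1 / ap ∧ |μm| < 1 / am := by
  rintro μp μm rfl
  have hc : 0 < |cross2 bp bm| := abs_pos.mpr hnc
  rw [cross2_smul_sub_smul_right, abs_neg, abs_mul, ← mul_assoc] at h1r
  rw [cross2_smul_sub_smul_left, abs_neg, abs_mul, ← mul_assoc] at h2r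
  have hp : ap * |μp| ≤ 1 - δ₀ := le_of_mul_le_mul_right h1r hc
  have hm : am * |μm| ≤ 1 - δ₀ := le_of_mul_le_mul_right h2r hc
  have hlt : 1 - δ₀ < 1 := sub_lt_self 1 hδ.1
  exact ⟨hp, hm, (lt_div_iff₀' hap).mpr (hp.trans_lt hlt), (lt_div_iff₀' ham).mpr (hm.trans_lt hlt)⟩
end

section
/- Let ρ > 0 and c_s > 0 be real numbers, let b ∈ ℝ³, let μ ∈ ℝ, and set F_p = 1/(ρ·c_s²) and c_A = ‖b‖/√ρ. Let δ ∈ (0,1) and assume μ²·ρ·(1 + (c_A/c_s)²) ≤ (1−δ)². Then for all vectors V, B ∈ ℝ³ (with the Euclidean inner product ⟨·,·⟩ and norm ‖·‖) and all P ∈ ℝ: ρ‖V‖² + ‖B‖² + F_p·P² − 2μρ·⟨V,B⟩ + 2μρ·F_p·P·⟨b,V⟩ ≥ δ·(ρ‖V‖² + ‖B‖² + F_p·P²). -/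
open scoped RealInnerProductSpace

/-- A weighted Cauchy–Schwarz inequality. -/
theorem norm_smul_sub_sq_le {E : Type*} [NormedAddCommGroup E] [InnerProductSpace ℝ E]
    {F : ℝ} (hF : 0 ≤ F) (P : ℝ) (b B : E) :
    ‖(F * P) • b - B‖ ^ 2 ≤ (1 + F * ‖b‖ ^ 2) * (‖B‖ ^ 2 + F * P ^ 2) := by
  have hcs : ⟪b, B⟫ ^ 2 ≤ ‖b‖ ^ 2 * ‖B‖ ^ 2 := by
    rw [← mul_pow]
    exact sq_le_sq' (neg_le_of_abs_le (abs_real_inner_le_norm b B)) (real_inner_le_norm b B)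
  rw [norm_sub_sq_real, norm_smul, real_inner_smul_left, mul_pow, Real.norm_eq_abs, sq_abs]
  have h : 0 ≤ F * ((P + ⟪b, B⟫) ^ 2 + (‖b‖ ^ 2 * ‖B‖ ^ 2 - ⟪b, B⟫ ^ 2)) :=
    mul_nonneg hF (add_nonneg (sq_nonneg _) (sub_nonneg.2 hcs))
  linarith

/-- A sum of squares dominates a cross term whose coefficient is small enough. -/
theorem add_inner_nonneg_of_sq_mul_norm_sq_le {E : Type*} [NormedAddCommGroup E]
    [InnerProductSpace ℝ E] {ρ ε μ Q : ℝ} (hρ : 0 ≤ ρ) (hε : 0 < ε) (V W : E)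
    (h : μ ^ 2 * ρ * ‖W‖ ^ 2 ≤ ε ^ 2 * Q) :
    0 ≤ ε * (ρ * ‖V‖ ^ 2 + Q) + 2 * μ * ρ * ⟪V, W⟫ := by
  refine nonneg_of_mul_nonneg_right ?_ hε
  have hsq : 0 ≤ ρ * ‖ε • V + μ • W‖ ^ 2 := by positivity
  rw [norm_add_sq_real, norm_smul, norm_smul, real_inner_smul_left, real_inner_smul_right,
    mul_pow, mul_pow, Real.norm_eq_abs, Real.norm_eq_abs, sq_abs, sq_abs] at hsq
  linarith

/-- Positive definiteness of the quadratic form in the tangential energy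
functional after Friedrichs secondary symmetrization: under the hyperbolicity
constraint `μ²ρ(1+(c_A/c_s)²) ≤ (1−δ)²` the symmetrized energy density
dominates `δ` times the unsymmetrized one. -/
theorem stmt_5 (ρ cs μ δ Fp cA : ℝ) (b : EuclideanSpace ℝ (Fin 3))
    (hρ : 0 < ρ) (hcs : 0 < cs) (hδ : δ ∈ Set.Ioo (0 : ℝ) 1)
    (hFp : Fp = 1 / (ρ * cs ^ 2)) (hcA : cA = ‖b‖ / Real.sqrt ρ)
    (hμ : μ ^ 2 * ρ * (1 + (cA / cs) ^ 2) ≤ (1 - δ) ^ 2) :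
    ∀ (V B : EuclideanSpace ℝ (Fin 3)) (P : ℝ),
      ρ * ‖V‖ ^ 2 + ‖B‖ ^ 2 + Fp * P ^ 2 - 2 * μ * ρ * ⟪V, B⟫ +
          2 * μ * ρ * Fp * P * ⟪b, V⟫ ≥
        δ * (ρ * ‖V‖ ^ 2 + ‖B‖ ^ 2 + Fp * P ^ 2) := by
  intro V B P
  have hF : 0 ≤ Fp := by rw [hFp]; positivity
  have hratio : (cA / cs) ^ 2 = Fp * ‖b‖ ^ 2 := by
    rw [hcA, hFp, div_pow, div_pow, Real.sq_sqrt hρ.le]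
    field_simp
  rw [hratio] at hμ
  have hQ : 0 ≤ ‖B‖ ^ 2 + Fp * P ^ 2 := by positivity
  have hW : μ ^ 2 * ρ * ‖(Fp * P) • b - B‖ ^ 2 ≤ (1 - δ) ^ 2 * (‖B‖ ^ 2 + Fp * P ^ 2) :=
    calc μ ^ 2 * ρ * ‖(Fp * P) • b - B‖ ^ 2
        ≤ μ ^ 2 * ρ * ((1 + Fp * ‖b‖ ^ 2) * (‖B‖ ^ 2 + Fp * P ^ 2)) := by
          gcongr
          exact norm_smul_sub_sq_le hF P b B
      _ = μ ^ 2 * ρ * (1 + Fp * ‖b‖ ^ 2) * (‖B‖ ^ 2 + Fp * P ^ 2) := by ring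
      _ ≤ _ := mul_le_mul_of_nonneg_right hμ hQ
  have key := add_inner_nonneg_of_sq_mul_norm_sq_le hρ.le (sub_pos.2 hδ.2) V _ hW
  rw [inner_sub_right, real_inner_smul_right, real_inner_comm b V] at key
  linarith
end

section
/- For vectors a, b ∈ ℝ², write a × b := a₁b₂ − a₂b₁ for the scalar cross product, and write a · b for the Euclidean inner product. Let ρ⁺, ρ⁻ > 0, let 𝐛⁺, 𝐛⁻, w ∈ ℝ², and let δ₀ ∈ (0,1). Assume 𝐛⁺ × 𝐛⁻ ≠ 0, |𝐛⁺ × w| ≤ (1−δ₀)·|𝐛⁺ × 𝐛⁻| and |𝐛⁻ × w| ≤ (1−δ₀)·|𝐛⁺ × 𝐛⁻|. Set u = (√(ρ⁺ρ⁻)/(ρ⁺+ρ⁻))·w. Then there exists δ' > 0 such that for all z ∈ ℝ²: ρ⁺·(𝐛⁺ · z)² + ρ⁻·(𝐛⁻ · z)² − (ρ⁺+ρ⁻)·(u · z)² ≥ δ'·‖z‖². -/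
/-- Euclidean inner product of two vectors in `ℝ²`. -/
def dot2 (a b : ℝ × ℝ) : ℝ := a.1 * b.1 + a.2 * b.2

/-- Expansion of `w` in terms of `a` and `b`, paired with `z`. -/
theorem cross2_mul_dot2 (a b w z : ℝ × ℝ) :
    cross2 a b * dot2 w z = cross2 a w * dot2 b z - cross2 b w * dot2 a z := by
  simp only [cross2, dot2]
  ring

/-- If `a × b ≠ 0`, then `z` is controlled by its pairings with `a` and `b`. -/
theorem sq_cross2_mul_le (a b z : ℝ × ℝ) :
    cross2 a b ^ 2 * (z.1 ^ 2 + z.2 ^ 2) ≤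
      (a.1 ^ 2 + a.2 ^ 2 + (b.1 ^ 2 + b.2 ^ 2)) * (dot2 a z ^ 2 + dot2 b z ^ 2) := by
  have key : (a.1 ^ 2 + a.2 ^ 2 + (b.1 ^ 2 + b.2 ^ 2)) * (dot2 a z ^ 2 + dot2 b z ^ 2) -
      cross2 a b ^ 2 * (z.1 ^ 2 + z.2 ^ 2) =
      (a.1 * dot2 a z + b.1 * dot2 b z) ^ 2 + (a.2 * dot2 a z + b.2 * dot2 b z) ^ 2 := by
    simp only [cross2, dot2]
    ring
  linarith [sq_nonneg (a.1 * dot2 a z + b.1 * dot2 b z),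
    sq_nonneg (a.2 * dot2 a z + b.2 * dot2 b z)]

/-- Cross-product bounds on `w` bound its pairing with `z` by those of `a` and `b`. -/
theorem abs_dot2_le {a b w : ℝ × ℝ} {c : ℝ} (hab : cross2 a b ≠ 0)
    (ha : |cross2 a w| ≤ c * |cross2 a b|) (hb : |cross2 b w| ≤ c * |cross2 a b|) (z : ℝ × ℝ) :
    |dot2 w z| ≤ c * (|dot2 a z| + |dot2 b z|) := by
  refine le_of_mul_le_mul_left ?_ (abs_pos.mpr hab)
  calc |cross2 a b| * |dot2 w z|
      = |cross2 a w * dot2 b z - cross2 b w * dot2 a z| := by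
        rw [← abs_mul, cross2_mul_dot2]
    _ ≤ |cross2 a w| * |dot2 b z| + |cross2 b w| * |dot2 a z| := by
        simpa only [abs_mul] using abs_sub (cross2 a w * dot2 b z) (cross2 b w * dot2 a z)
    _ ≤ c * |cross2 a b| * |dot2 b z| + c * |cross2 a b| * |dot2 a z| := by gcongr
    _ = |cross2 a b| * (c * (|dot2 a z| + |dot2 b z|)) := by ring

/-- Weighted Cauchy–Schwarz inequality. -/
theorem mul_add_sq_le_add_mul (p q x y : ℝ) :
    p * q * (x + y) ^ 2 ≤ (p + q) * (p * x ^ 2 + q * y ^ 2) := by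
  linarith [sq_nonneg (p * x - q * y)]

/-- Ellipticity of the interface operator under the Syrovatskii-type stability
condition: the quadratic form `ρ⁺(𝐛⁺·z)² + ρ⁻(𝐛⁻·z)² − (ρ⁺+ρ⁻)(u·z)²` with
`u = (√(ρ⁺ρ⁻)/(ρ⁺+ρ⁻))·w` is uniformly positive definite. -/
theorem stmt_6 (ρp ρm δ₀ : ℝ) (bp bm w : ℝ × ℝ)
    (hρp : 0 < ρp) (hρm : 0 < ρm) (hδ : δ₀ ∈ Set.Ioo (0 : ℝ) 1)
    (hnc : cross2 bp bm ≠ 0)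
    (h1 : |cross2 bp w| ≤ (1 - δ₀) * |cross2 bp bm|)
    (h2 : |cross2 bm w| ≤ (1 - δ₀) * |cross2 bp bm|) :
    ∃ δ' > (0 : ℝ), ∀ z : ℝ × ℝ,
      ρp * (dot2 bp z) ^ 2 + ρm * (dot2 bm z) ^ 2 -
          (ρp + ρm) * (dot2 ((Real.sqrt (ρp * ρm) / (ρp + ρm)) • w) z) ^ 2 ≥
        δ' * (z.1 ^ 2 + z.2 ^ 2) := by
  obtain ⟨hδ0, hδ1⟩ := hδ
  set c := 1 - δ₀ with hc
  have hc2 : 0 < 1 - c ^ 2 := by nlinarith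
  set S := bp.1 ^ 2 + bp.2 ^ 2 + (bm.1 ^ 2 + bm.2 ^ 2) with hS
  have hm : 0 < min ρp ρm := lt_min hρp hρm
  have hC : 0 < cross2 bp bm ^ 2 := by positivity
  have hSpos : 0 < S := by
    refine lt_of_le_of_ne (by positivity) fun h => ?_
    have h0 := sq_cross2_mul_le bp bm (1, 0)
    rw [← hS, ← h] at h0
    norm_num at h0
    exact hnc h0
  refine ⟨(1 - c ^ 2) * min ρp ρm * (cross2 bp bm ^ 2 / S), by positivity, fun z => ?_⟩
  have hu : (ρp + ρm) * dot2 ((Real.sqrt (ρp * ρm) / (ρp + ρm)) • w) z ^ 2 =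
      ρp * ρm * dot2 w z ^ 2 / (ρp + ρm) := by
    have hsq := Real.sq_sqrt (mul_pos hρp hρm).le
    have hlin : dot2 ((Real.sqrt (ρp * ρm) / (ρp + ρm)) • w) z =
        Real.sqrt (ρp * ρm) / (ρp + ρm) * dot2 w z := by
      simp only [dot2, Prod.smul_fst, Prod.smul_snd, smul_eq_mul]
      ring
    rw [hlin, mul_pow, div_pow, hsq]
    field_simp
  have hW : dot2 w z ^ 2 ≤ c ^ 2 * (|dot2 bp z| + |dot2 bm z|) ^ 2 := by
    rw [← mul_pow, ← sq_abs (dot2 w z)]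
    exact pow_le_pow_left₀ (abs_nonneg _) (abs_dot2_le hnc h1 h2 z) 2
  have hWu : ρp * ρm * dot2 w z ^ 2 / (ρp + ρm) ≤
      c ^ 2 * (ρp * dot2 bp z ^ 2 + ρm * dot2 bm z ^ 2) := by
    rw [div_le_iff₀ (by positivity)]
    have hcs := mul_add_sq_le_add_mul ρp ρm |dot2 bp z| |dot2 bm z|
    rw [sq_abs, sq_abs] at hcs
    linarith [mul_le_mul_of_nonneg_left hW (mul_pos hρp hρm).le,
      mul_le_mul_of_nonneg_left hcs (sq_nonneg c)]
  have hz : cross2 bp bm ^ 2 / S * (z.1 ^ 2 + z.2 ^ 2) ≤ dot2 bp z ^ 2 + dot2 bm z ^ 2 := by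
    rw [div_mul_eq_mul_div, div_le_iff₀' hSpos]
    exact sq_cross2_mul_le bp bm z
  have hmin : min ρp ρm * (dot2 bp z ^ 2 + dot2 bm z ^ 2) ≤
      ρp * dot2 bp z ^ 2 + ρm * dot2 bm z ^ 2 := by
    rw [mul_add]
    gcongr
    · exact min_le_left _ _
    · exact min_le_right _ _
  rw [hu, ge_iff_le]
  calc (1 - c ^ 2) * min ρp ρm * (cross2 bp bm ^ 2 / S) * (z.1 ^ 2 + z.2 ^ 2)
      = (1 - c ^ 2) * (min ρp ρm * (cross2 bp bm ^ 2 / S * (z.1 ^ 2 + z.2 ^ 2))) := by ring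
    _ ≤ (1 - c ^ 2) * (ρp * dot2 bp z ^ 2 + ρm * dot2 bm z ^ 2) := by
        refine mul_le_mul_of_nonneg_left (le_trans ?_ hmin) hc2.le
        exact mul_le_mul_of_nonneg_left hz hm.le
    _ ≤ _ := by linarith
end

section
/- Let ρ⁺, ρ⁻ > 0 and let x, y, V, δ₀ be real numbers with δ₀ > 0, V ≠ 0 and |x| + |y| ≥ (1+δ₀)·|V|. Set u = (√(ρ⁺ρ⁻)/(ρ⁺+ρ⁻))·V. Then ρ⁺·(x² − u²) + ρ⁻·(y² − u²) > 0. -/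
/-- 2D ellipticity: if `|x| + |y| ≥ (1+δ₀)|V|` with `V ≠ 0`, then
`ρ⁺(x² − u²) + ρ⁻(y² − u²) > 0` for `u = (√(ρ⁺ρ⁻)/(ρ⁺+ρ⁻))·V`. -/
theorem stmt_7 (ρp ρm x y V δ₀ : ℝ) (hρp : 0 < ρp) (hρm : 0 < ρm)
    (hδ : 0 < δ₀) (hV : V ≠ 0) (h : |x| + |y| ≥ (1 + δ₀) * |V|) :
    ρp * (x ^ 2 - (Real.sqrt (ρp * ρm) / (ρp + ρm) * V) ^ 2) +
      ρm * (y ^ 2 - (Real.sqrt (ρp * ρm) / (ρp + ρm) * V) ^ 2) > 0 := by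
  have hV0 : 0 < |V| := abs_pos.mpr hV
  have hlt : V ^ 2 < (|x| + |y|) ^ 2 := by
    rw [← sq_abs V]
    have : |V| < |x| + |y| := by nlinarith [mul_pos hδ hV0]
    gcongr
  have hs : 0 < ρp + ρm := add_pos hρp hρm
  have key : 0 < (ρp * x ^ 2 + ρm * y ^ 2) * (ρp + ρm) - ρp * ρm * V ^ 2 := by
    rw [← sq_abs x, ← sq_abs y]
    nlinarith [mul_lt_mul_of_pos_left hlt (mul_pos hρp hρm),
      sq_nonneg (ρp * |x| - ρm * |y|)]
  have heq : ρp * (x ^ 2 - (Real.sqrt (ρp * ρm) / (ρp + ρm) * V) ^ 2) +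
      ρm * (y ^ 2 - (Real.sqrt (ρp * ρm) / (ρp + ρm) * V) ^ 2) =
      ((ρp * x ^ 2 + ρm * y ^ 2) * (ρp + ρm) - ρp * ρm * V ^ 2) / (ρp + ρm) := by
    rw [mul_pow, div_pow, Real.sq_sqrt (mul_pos hρp hρm).le]
    field_simp
    ring
  rw [heq]
  exact div_pos key hs
end

section
/- Let n ≥ 1 and let c : ℝⁿ → ℝ and Λ : ℝⁿ × ℝⁿ → ℝ be functions such that c is differentiable, c(x) > 0 for all x, and for each fixed ξ the map x ↦ Λ(x,ξ) is differentiable while for each fixed x the map ξ ↦ Λ(x,ξ) is differentiable. Define ℌ(x,ξ) = c(x)²·Λ(x,ξ)² and 𝔫(x) = c(x)^{1/3}. Then for all (x,ξ): 𝔫(x)·( (1/2)·⟨∇_ξℌ(x,ξ), ∇ₓΛ(x,ξ)⟩ − (1/2)·⟨∇ₓℌ(x,ξ), ∇_ξΛ(x,ξ)⟩ ) = −⟨∇_ξ(Λ·ℌ)(x,ξ), ∇ₓ𝔫(x)⟩, where ∇ₓ denotes the gradient in the first (spatial) variable, ∇_ξ the gradient in the second (frequency) variable, and ⟨·,·⟩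 the Euclidean inner product on ℝⁿ. -/
open scoped RealInnerProductSpace

section GradientCalculus

variable {F : Type*} [NormedAddCommGroup F] [InnerProductSpace ℝ F] [CompleteSpace F]

theorem HasGradientAt.mul_real {f g : F → ℝ} {f' g' x : F}
    (hf : HasGradientAt f f' x) (hg : HasGradientAt g g' x) :
    HasGradientAt (fun y => f y * g y) (f x • g' + g x • f') x := by
  rw [hasGradientAt_iff_hasFDerivAt] at *
  rw [map_add, map_smul, map_smul]
  exact hf.mul hg

theorem HasDerivAt.comp_hasGradientAt_real {φ : ℝ → ℝ} {φ' : ℝ} {f : F → ℝ} {f' x : F}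
    (hφ : HasDerivAt φ φ' (f x)) (hf : HasGradientAt f f' x) :
    HasGradientAt (fun y => φ (f y)) (φ' • f') x := by
  rw [hasGradientAt_iff_hasFDerivAt] at *
  rw [map_smul]
  exact hφ.comp_hasFDerivAt x hf

end GradientCalculus

/-- The symbolic (Poisson-bracket) equation for the paradifferential
symmetrizer: with `ℌ(x,ξ) = c(x)²Λ(x,ξ)²` and `𝔫(x) = c(x)^{1/3}`, one has
`𝔫·(½⟨∇_ξℌ, ∇ₓΛ⟩ − ½⟨∇ₓℌ, ∇_ξΛ⟩) = −⟨∇_ξ(Λℌ), ∇ₓ𝔫⟩`. -/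
theorem stmt_14 (n : ℕ) (hn : 1 ≤ n)
    (c : EuclideanSpace ℝ (Fin n) → ℝ)
    (Λ : EuclideanSpace ℝ (Fin n) → EuclideanSpace ℝ (Fin n) → ℝ)
    (hc : Differentiable ℝ c) (hcpos : ∀ x, 0 < c x)
    (hΛx : ∀ ξ, Differentiable ℝ (fun x => Λ x ξ))
    (hΛξ : ∀ x, Differentiable ℝ (fun ξ => Λ x ξ)) :
    ∀ x ξ : EuclideanSpace ℝ (Fin n),
      c x ^ ((1 : ℝ) / 3) *
          ((1 / 2 : ℝ) * ⟪gradient (fun η => c x ^ 2 * Λ x η ^ 2) ξ,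
              gradient (fun y => Λ y ξ) x⟫ -
            (1 / 2 : ℝ) * ⟪gradient (fun y => c y ^ 2 * Λ y ξ ^ 2) x,
              gradient (fun η => Λ x η) ξ⟫) =
        -⟪gradient (fun η => Λ x η * (c x ^ 2 * Λ x η ^ 2)) ξ,
            gradient (fun y => c y ^ ((1 : ℝ) / 3)) x⟫ := by
  intro x ξ
  have hcx := (hc x).hasGradientAt
  have hLx := (hΛx ξ x).hasGradientAt
  have hLξ := (hΛξ x ξ).hasGradientAt
  have hsq (t : ℝ) : HasDerivAt (fun s : ℝ => s ^ 2) (2 * t) t := by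
    simpa using hasDerivAt_pow 2 t
  have hHx := ((hsq (c x)).comp_hasGradientAt_real hcx).mul_real
    ((hsq (Λ x ξ)).comp_hasGradientAt_real (f := fun y => Λ y ξ) hLx)
  have hN := (Real.hasDerivAt_rpow_const (p := (1 : ℝ) / 3)
    (Or.inl (hcpos x).ne')).comp_hasGradientAt_real hcx
  have hHξ : HasGradientAt (fun η => c x ^ 2 * Λ x η ^ 2) _ ξ :=
    ((hsq (Λ x ξ)).const_mul (c x ^ 2)).comp_hasGradientAt_real hLξ
  have hLH := hLξ.mul_real hHξ
  rw [hHξ.gradient, hHx.gradient, hLH.gradient, hN.gradient]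
  have hpow : c x ^ ((1 : ℝ) / 3) = c x * c x ^ ((1 : ℝ) / 3 - 1) := by
    rw [Real.rpow_sub_one (hcpos x).ne', mul_div_cancel₀ _ (hcpos x).ne']
  simp only [inner_add_left, real_inner_smul_left, real_inner_smul_right]
  rw [hpow, real_inner_comm (gradient c x) (gradient (fun η => Λ x η) ξ),
    real_inner_comm (gradient (fun y => Λ y ξ) x) (gradient (fun η => Λ x η) ξ)]
  ring
end
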